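/- Assume the positive integers a_1, …, a_r are pairwise distinct. For every n ≥ μ_r − 1, the following identity holds in ℚ: deg I_n = Σ_{i=1}^{r} a_i^{n−μ_r+r} / ∏_{j≠i} (a_i − a_j). -/

import Mathlib

open MvPolynomial

noncomputable section

/-- The monomial `x_{μ 0}^{a 0} ⋯ x_{μ (r-1)}^{a (r-1)}` in `K[X] = K[x_j : j ≥ 1]`
(variables indexed by `ℕ`; only indices `≥ 1` occur). -/
def orbMon (K : Type*) [Field K] (r : ℕ) (μ a : ℕ → ℕ) : MvPolynomial ℕ K :=
  ∏ j ∈ Finset.range r, (X (μ j) : MvPolynomial ℕ K) ^ a j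

/-- The ideal generated by the `Inc`-orbit of a polynomial, where the monoid `Inc` of
strictly increasing maps acts by renaming the indices of the variables. -/
def orbitIdeal (K : Type*) [Field K] (m : MvPolynomial ℕ K) : Ideal (MvPolynomial ℕ K) :=
  Ideal.span {q | ∃ π : ℕ → ℕ, StrictMono π ∧ q = rename π m}

/-- Index type for the variables `x_1, …, x_n` of `K[X_n]`. -/
abbrev VarIdx (n : ℕ) := {j : ℕ // j ∈ Finset.Icc 1 n}

/-- The inclusion `K[X_n] → K[X]`. -/
def toBig (K : Type*) [Field K] (n : ℕ) : MvPolynomial (VarIdx n) K →ₐ[K] MvPolynomial ℕ K :=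
  rename Subtype.val

/-- `I_n = I ∩ K[X_n]`, realized as an ideal of `K[X_n]` (this is legitimate because
`toBig` is injective). -/
def restr (K : Type*) [Field K] (I : Ideal (MvPolynomial ℕ K)) (n : ℕ) :
    Ideal (MvPolynomial (VarIdx n) K) :=
  Ideal.comap (toBig K n) I

/-- The inclusion `K[X_m] → K[X_n]` for `m ≤ n`. -/
def incl (K : Type*) [Field K] {m n : ℕ} (h : m ≤ n) :
    MvPolynomial (VarIdx m) K →ₐ[K] MvPolynomial (VarIdx n) K :=
  rename fun j => ⟨j.1, Finset.Icc_subset_Icc le_rfl h j.2⟩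

/-- The dimension of the degree `j` component of `K[X_n]/I`, for a homogeneous ideal `I`:
the `K`-dimension of (homogeneous polynomials of degree `j`) modulo (those lying in `I`). -/
def hilbF (K : Type*) [Field K] {σ : Type*} (I : Ideal (MvPolynomial σ K)) (j : ℕ) : ℕ :=
  Module.finrank K
    (↥(homogeneousSubmodule σ K j) ⧸
      (Submodule.comap (homogeneousSubmodule σ K j).subtype (Submodule.restrictScalars K I)))

/-- The Hilbert series of `K[X_n]/I` as a power series in `ℤ[[t]]`. -/
def hseries (K : Type*) [Field K] {σ : Type*} (I : Ideal (MvPolynomial σ K)) :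
    PowerSeries ℤ :=
  PowerSeries.mk fun j => (hilbF K I j : ℤ)

end

section HilbertFunction

open Finsupp

/-- If membership in `I` is decided monomial by monomial, the Hilbert function of `I` counts the
monomials outside `I`. -/
lemma hilbF_eq_card {K : Type*} [Field K] {σ : Type*} {I : Ideal (MvPolynomial σ K)}
    {C : (σ →₀ ℕ) → Prop} (hI : ∀ f, f ∈ I ↔ ∀ u ∈ f.support, C u) (j : ℕ)
    (T : Finset (σ →₀ ℕ)) (hT : ∀ u, u ∈ T ↔ u.degree = j ∧ ¬ C u) :
    hilbF K I j = T.card := by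
  classical
  let φ : homogeneousSubmodule σ K j →ₗ[K] (T → K) :=
    LinearMap.pi fun u => (MvPolynomial.lcoeff K u.1) ∘ₗ (homogeneousSubmodule σ K j).subtype
  have hφ : ∀ f u, φ f u = coeff u.1 f.1 := fun _ _ => rfl
  have hker : LinearMap.ker φ =
      Submodule.comap (homogeneousSubmodule σ K j).subtype (Submodule.restrictScalars K I) := by
    ext f
    rw [LinearMap.mem_ker, Submodule.mem_comap, Submodule.restrictScalars_mem,
      Submodule.subtype_apply, hI]
    constructor
    · intro h u hu
      by_contra hC
      have hdeg : u.degree = j := by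
        rw [degree_eq_weight_one]
        exact f.2 (MvPolynomial.mem_support_iff.1 hu)
      exact MvPolynomial.mem_support_iff.1 hu (congrFun h ⟨u, (hT u).2 ⟨hdeg, hC⟩⟩)
    · intro h
      ext u
      by_contra hu
      exact ((hT _).1 u.2).2 (h u.1 (MvPolynomial.mem_support_iff.2 hu))
  have hsurj : Function.Surjective φ := by
    intro g
    refine ⟨⟨∑ u : T, monomial u.1 (g u), Submodule.sum_mem _ fun u _ => ?_⟩, ?_⟩
    · exact isHomogeneous_monomial _ ((hT _).1 u.2).1
    · ext v
      rw [hφ]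
      rw [MvPolynomial.coeff_sum, Finset.sum_eq_single v]
      · rw [MvPolynomial.coeff_monomial, if_pos rfl]
      · intro u _ huv
        rw [MvPolynomial.coeff_monomial, if_neg fun h => huv (Subtype.ext h)]
      · simp
  unfold hilbF
  rw [← hker, (φ.quotKerEquivOfSurjective hsurj).finrank_eq]
  simp

end HilbertFunction

section Counting

open Finset

open scoped Classical in
/-- The generating function, by degree, of the exponent vectors supported in `s` that satisfy
`P`. -/
noncomputable def expSeries (s : Finset ℕ) (P : (ℕ →₀ ℕ) → Prop) : PowerSeries ℤ :=
  PowerSeries.mk fun j => (#{u ∈ finsuppAntidiag s j | P u} : ℤ)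

/-- The predicate `P` does not depend on the `n`-th coordinate. -/
def IndepOf (n : ℕ) (P : (ℕ →₀ ℕ) → Prop) : Prop :=
  ∀ u v : ℕ →₀ ℕ, (∀ i, i ≠ n → u i = v i) → P u → P v

lemma expSeries_congr {s : Finset ℕ} {P Q : (ℕ →₀ ℕ) → Prop}
    (h : ∀ u, P u ↔ Q u) : expSeries s P = expSeries s Q := by
  rw [funext fun u => propext (h u)]

lemma expSeries_false (s : Finset ℕ) : expSeries s (fun _ => False) = 0 := by
  ext j
  simp [expSeries]

lemma expSeries_split (s : Finset ℕ) (P Q : (ℕ →₀ ℕ) → Prop) :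
    expSeries s P = expSeries s (fun u => P u ∧ Q u) + expSeries s (fun u => P u ∧ ¬ Q u) := by
  classical
  ext j
  simp only [expSeries, map_add, PowerSeries.coeff_mk]
  rw [← Finset.card_filter_add_card_filter_not (s := {u ∈ finsuppAntidiag s j | P u}) Q,
    Finset.filter_filter, Finset.filter_filter]
  push_cast
  congr

lemma expSeries_shift {s : Finset ℕ} {n : ℕ} (hn : n ∈ s) {P : (ℕ →₀ ℕ) → Prop}
    (hP : IndepOf n P) (a : ℕ) :
    expSeries s (fun u => P u ∧ a ≤ u n) = PowerSeries.X ^ a * expSeries s P := by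
  classical
  ext j
  rw [PowerSeries.coeff_X_pow_mul']
  simp only [expSeries, PowerSeries.coeff_mk]
  have hle : ∀ u ∈ finsuppAntidiag s j, u n ≤ j := by
    intro u hu
    rw [mem_finsuppAntidiag] at hu
    rw [← hu.1]
    exact Finset.single_le_sum (f := fun i => u i) (fun _ _ => Nat.zero_le _) hn
  have hsum : s.sum (Finsupp.single n a) = a := by
    simp [Finsupp.single_apply, hn]
  split_ifs with haj
  · norm_cast
    refine Finset.card_bij' (fun u _ => u - Finsupp.single n a) (fun u _ => u + Finsupp.single n a)
      ?_ ?_ ?_ ?_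
    · intro u hu
      simp only [mem_filter, mem_finsuppAntidiag] at hu ⊢
      have hs : u - Finsupp.single n a + Finsupp.single n a = u :=
        tsub_add_cancel_of_le (by simpa using hu.2.2)
      refine ⟨⟨?_, ?_⟩, hP u _ ?_ hu.2.1⟩
      · have h1 : s.sum (u - Finsupp.single n a) + s.sum (Finsupp.single n a) = s.sum u := by
          conv_rhs => rw [← hs]
          rw [← Finset.sum_add_distrib]
          rfl
        omega
      · intro i hi
        apply hu.1.2
        simp only [Finsupp.mem_support_iff, Finsupp.tsub_apply] at hi ⊢
        omega
      · intro i hi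
        simp [Ne.symm hi]
    · intro u hu
      simp only [mem_filter, mem_finsuppAntidiag] at hu ⊢
      refine ⟨⟨?_, ?_⟩, hP u _ ?_ hu.2, by simp⟩
      · have h1 : s.sum (u + Finsupp.single n a) = s.sum u + s.sum (Finsupp.single n a) := by
          rw [← Finset.sum_add_distrib]
          rfl
        omega
      · intro i hi
        by_cases h : i = n
        · exact h ▸ hn
        · apply hu.1.2
          simpa [Finsupp.single_apply, Ne.symm h] using hi
      · intro i hi
        simp [Ne.symm hi]
    · intro u hu
      simp only [mem_filter] at hu
      exact tsub_add_cancel_of_le (by simpa using hu.2.2)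
    · intro u hu
      simp
  · norm_cast
    rw [Finset.card_eq_zero, Finset.filter_eq_empty_iff]
    intro u hu h
    exact haj (h.2.trans (hle u hu))

lemma expSeries_insert {s : Finset ℕ} {n : ℕ} (hn : n ∉ s) {P : (ℕ →₀ ℕ) → Prop}
    (hP : IndepOf n P) :
    (1 - PowerSeries.X) * expSeries (insert n s) P = expSeries s P := by
  classical
  have h0 : expSeries (insert n s) (fun u => P u ∧ ¬ 1 ≤ u n) = expSeries s P := by
    ext j
    simp only [expSeries, PowerSeries.coeff_mk]
    congr 2
    ext u
    simp only [mem_filter, mem_finsuppAntidiag, Finset.sum_insert hn, Finset.subset_iff,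
      Finset.mem_insert]
    constructor
    · rintro ⟨⟨h1, h2⟩, h3, h4⟩
      have h5 : u n = 0 := by omega
      rw [h5, zero_add] at h1
      refine ⟨⟨h1, fun i hi => (h2 hi).resolve_left ?_⟩, h3⟩
      rintro rfl
      simp only [Finsupp.mem_support_iff] at hi
      omega
    · rintro ⟨⟨h1, h2⟩, h3⟩
      have h4 : u n = 0 := by
        by_contra h
        exact hn (h2 (Finsupp.mem_support_iff.2 h))
      exact ⟨⟨by rw [h4, zero_add]; exact h1, fun i hi => Or.inr (h2 hi)⟩, h3, by omega⟩
  have h1 := expSeries_split (insert n s) P fun u => 1 ≤ u n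
  rw [expSeries_shift (Finset.mem_insert_self n s) hP, h0] at h1
  linear_combination h1

lemma expSeries_insert_of_cases {s : Finset ℕ} {n : ℕ} (hn : n ∉ s) {P A B : (ℕ →₀ ℕ) → Prop}
    (hA : IndepOf n A) (hB : IndepOf n B) (a : ℕ) (hPA : ∀ u, u n < a → (P u ↔ A u))
    (hPB : ∀ u, a ≤ u n → (P u ↔ B u)) :
    (1 - PowerSeries.X) * expSeries (insert n s) P =
      (1 - PowerSeries.X ^ a) * expSeries s A + PowerSeries.X ^ a * expSeries s B := by
  have hP := expSeries_split (insert n s) P fun u => a ≤ u n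
  have hA' := expSeries_split (insert n s) A fun u => a ≤ u n
  rw [expSeries_congr (Q := fun u => B u ∧ a ≤ u n) fun u => and_congr_left (hPB u),
    expSeries_congr (Q := fun u => A u ∧ ¬ a ≤ u n)
      fun u => and_congr_left fun h => hPA u (not_le.1 h),
    expSeries_shift (Finset.mem_insert_self n s) hB] at hP
  rw [expSeries_shift (Finset.mem_insert_self n s) hA] at hA'
  rw [← expSeries_insert hn hA, ← expSeries_insert hn hB]
  linear_combination (1 - PowerSeries.X) * (hP - hA')

lemma one_sub_X_pow_mul_expSeries {P : (ℕ →₀ ℕ) → Prop} {m : ℕ} (d : ℕ)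
    (hP : ∀ i, m < i → IndepOf i P) :
    (1 - PowerSeries.X) ^ d * expSeries (Icc 1 (m + d)) P = expSeries (Icc 1 m) P := by
  induction d with
  | zero => simp
  | succ d ih =>
    rw [pow_succ, mul_assoc, ← add_assoc, ← Finset.insert_Icc_right_eq_Icc_add_one (by omega),
      expSeries_insert (by simp) (hP _ (by omega)), ih]

lemma expSeries_empty_true : expSeries ∅ (fun _ => True) = 1 := by
  ext j
  rw [PowerSeries.coeff_one]
  by_cases hj : j = 0 <;> simp [expSeries, hj]

end Counting

section Orbit

/-- The monomial with exponent vector `u` in `x_1, …, x_n` is divisible by an element of the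
`Inc`-orbit of `x_{μ 0}^{a 0} ⋯ x_{μ (r-1)}^{a (r-1)}`. -/
def OrbitDivides (μ a : ℕ → ℕ) (r n : ℕ) (u : ℕ →₀ ℕ) : Prop :=
  ∃ π : ℕ → ℕ, StrictMono π ∧ ∀ k < r, π (μ k) ≤ n ∧ a k ≤ u (π (μ k))

variable {μ a : ℕ → ℕ}

lemma OrbitDivides.indepOf {r n i : ℕ} (h : n < i) :
    IndepOf i fun u => ¬ OrbitDivides μ a r n u := by
  rintro u v huv hu ⟨π, hπ, hv⟩
  refine hu ⟨π, hπ, fun k hk => ⟨(hv k hk).1, ?_⟩⟩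
  rw [huv _ (by have := (hv k hk).1; omega)]
  exact (hv k hk).2

lemma not_orbitDivides_of_lt {r n : ℕ} (h : n < μ r) (u : ℕ →₀ ℕ) :
    ¬ OrbitDivides μ a (r + 1) n u := by
  rintro ⟨π, hπ, hu⟩
  have h1 := (hu r (by omega)).1
  have h2 := hπ.le_apply (x := μ r)
  omega

lemma OrbitDivides.mono {r m n : ℕ} (h : m ≤ n) {u : ℕ →₀ ℕ} (hu : OrbitDivides μ a r m u) :
    OrbitDivides μ a r n u := by
  obtain ⟨π, hπ, hu⟩ := hu
  exact ⟨π, hπ, fun k hk => ⟨(hu k hk).1.trans h, (hu k hk).2⟩⟩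

/-- Increasing maps can be prescribed to send `m` to `n ≥ m`, extending a given increasing
map on an initial segment. -/
lemma exists_strictMono_extend {π : ℕ → ℕ} (hπ : StrictMono π) {l m n : ℕ} (hlm : l < m)
    (h : π l + (m - l) ≤ n) :
    ∃ ρ : ℕ → ℕ, StrictMono ρ ∧ (∀ x ≤ l, ρ x = π x) ∧ ρ m = n := by
  have hl := hπ.le_apply (x := l)
  refine ⟨fun x => if x ≤ l then π x else x + (n - m), ?_, fun x hx => if_pos hx, ?_⟩
  · refine strictMono_nat_of_lt_succ fun x => ?_
    split_ifs with h1 h2 h2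
    · exact hπ (Nat.lt_succ_self x)
    · obtain rfl : x = l := by omega
      omega
    · omega
    · omega
  · dsimp only
    rw [if_neg (by omega)]
    omega

lemma StrictMono.le_sub_of_le {π : ℕ → ℕ} (hπ : StrictMono π) {l m n : ℕ} (hlm : l < m)
    (h : π m ≤ n) : π l + (m - l) ≤ n := by
  have h1 := hπ.add_le_nat (m - l) l
  rw [Nat.sub_add_cancel hlm.le] at h1
  omega

lemma le_of_forall_lt_succ {r : ℕ} (hμ : ∀ j, j + 1 < r → μ j < μ (j + 1)) {i j : ℕ} (hij : i ≤ j)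
    (hj : j < r) : μ i ≤ μ j := by
  induction j, hij using Nat.le_induction with
  | base => exact le_rfl
  | succ j hij ih => exact (ih (by omega)).trans (hμ j hj).le

lemma orbitDivides_succ_of_lt {r n : ℕ} {u : ℕ →₀ ℕ} (hμ : ∀ j, j < r → μ j < μ (j + 1))
    (hu : u (n + 1) < a r) :
    OrbitDivides μ a (r + 1) (n + 1) u ↔ OrbitDivides μ a (r + 1) n u := by
  refine ⟨?_, OrbitDivides.mono (Nat.le_succ n)⟩
  rintro ⟨π, hπ, h⟩
  refine ⟨π, hπ, fun k hk => ⟨?_, (h k hk).2⟩⟩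
  have h1 : π (μ k) ≤ π (μ r) := hπ.monotone
    (le_of_forall_lt_succ (r := r + 1) (fun j hj => hμ j (by omega)) (by omega) (by omega))
  have h2 := h r (by omega)
  have h3 : π (μ r) ≠ n + 1 := fun h3 => by
    rw [h3] at h2
    omega
  omega

lemma orbitDivides_one_of_le {n : ℕ} {u : ℕ →₀ ℕ} (hn : μ 0 ≤ n) (hu : a 0 ≤ u n) :
    OrbitDivides μ a 1 n u := by
  refine ⟨fun x => x + (n - μ 0), fun x y h => Nat.add_lt_add_right h _, fun k hk => ?_⟩
  obtain rfl : k = 0 := by omega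
  simp only [Nat.add_sub_cancel' hn]
  exact ⟨le_rfl, hu⟩

lemma orbitDivides_succ_of_le {r n : ℕ} {u : ℕ →₀ ℕ} (hμ : ∀ j, j < r + 1 → μ j < μ (j + 1))
    (hn : μ (r + 1) ≤ n) (hu : a (r + 1) ≤ u n) :
    OrbitDivides μ a (r + 2) n u ↔
      OrbitDivides μ a (r + 1) (n - (μ (r + 1) - μ r)) u := by
  have hle : ∀ k < r + 1, μ k ≤ μ r := fun k hk =>
    le_of_forall_lt_succ (r := r + 1) (fun j hj => hμ j (by omega)) (by omega) (by omega)
  have hr := hμ r (by omega)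
  constructor
  · rintro ⟨π, hπ, h⟩
    refine ⟨π, hπ, fun k hk => ⟨?_, (h k (by omega)).2⟩⟩
    have h1 := hπ.le_sub_of_le hr (h (r + 1) (by omega)).1
    have h2 := hπ.monotone (hle k hk)
    omega
  · rintro ⟨π, hπ, h⟩
    have h1 := (h r (by omega)).1
    obtain ⟨ρ, hρ, hρ1, hρ2⟩ := exists_strictMono_extend hπ hr (n := n) (by omega)
    refine ⟨ρ, hρ, fun k hk => ?_⟩
    rcases Nat.lt_succ_iff_lt_or_eq.1 hk with hk' | rfl
    · rw [hρ1 _ (hle k hk')]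
      exact ⟨(h k hk').1.trans (Nat.sub_le _ _), (h k hk').2⟩
    · rw [hρ2]
      exact ⟨le_rfl, hu⟩

end Orbit

section Membership

open Finsupp

lemma orbMon_eq_monomial (K : Type*) [Field K] (r : ℕ) (μ a : ℕ → ℕ) :
    orbMon K r μ a = monomial (∑ j ∈ Finset.range r, single (μ j) (a j)) 1 := by
  rw [orbMon, monomial_sum_one]
  simp [X_pow_eq_monomial]

lemma mem_restr_orbitIdeal_iff (K : Type*) [Field K] {r n : ℕ} {μ a : ℕ → ℕ}
    (hμ : ∀ j, j + 1 < r → μ j < μ (j + 1)) (ha : ∀ j, j < r → 0 < a j)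
    (f : MvPolynomial (VarIdx n) K) :
    f ∈ restr K (orbitIdeal K (orbMon K r μ a)) n ↔
      ∀ u ∈ f.support, OrbitDivides μ a r n (u.mapDomain Subtype.val) := by
  classical
  have hspan : orbitIdeal K (orbMon K r μ a) = Ideal.span ((fun s => monomial s (1 : K)) ''
      {s | ∃ π : ℕ → ℕ, StrictMono π ∧
        s = ∑ j ∈ Finset.range r, single (π (μ j)) (a j)}) := by
    unfold orbitIdeal
    congr 1
    ext q
    simp only [orbMon_eq_monomial, rename_monomial, mapDomain_finsetSum, mapDomain_single,
      Set.mem_ofPred_eq, Set.mem_image]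
    constructor
    · rintro ⟨π, hπ, rfl⟩
      exact ⟨_, ⟨π, hπ, rfl⟩, rfl⟩
    · rintro ⟨_, ⟨π, hπ, rfl⟩, rfl⟩
      exact ⟨π, hπ, rfl⟩
  rw [restr, Ideal.mem_comap, toBig, hspan, mem_ideal_span_monomial_image,
    support_rename_of_injective Subtype.val_injective, Finset.forall_mem_image]
  refine forall₂_congr fun u _ => ?_
  have hlt : ∀ i j, i < j → j < r → μ i < μ j := by
    intro i j hij hj
    exact (hμ i (by omega)).trans_le (le_of_forall_lt_succ hμ hij hj)
  have hval : ∀ π : ℕ → ℕ, StrictMono π → ∀ k < r,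
      (∑ j ∈ Finset.range r, single (π (μ j)) (a j)) (π (μ k)) = a k := by
    intro π hπ k hk
    rw [finsetSum_apply, Finset.sum_eq_single k]
    · simp
    · intro j hj hjk
      rw [Finset.mem_range] at hj
      refine single_eq_of_ne' fun h => ?_
      have h' := hπ.injective h
      rcases lt_or_gt_of_ne hjk with h1 | h1
      · have := hlt j k h1 hk
        omega
      · have := hlt k j h1 hj
        omega
    · simp [hk]
  constructor
  · rintro ⟨_, ⟨π, hπ, rfl⟩, hle⟩
    refine ⟨π, hπ, fun k hk => ?_⟩
    have h1 := hle (π (μ k))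
    rw [hval π hπ k hk] at h1
    refine ⟨?_, h1⟩
    have h2 : π (μ k) ∈ (u.mapDomain Subtype.val).support := by
      rw [Finsupp.mem_support_iff]
      have := ha k hk
      omega
    obtain ⟨i, -, hi⟩ := Finset.mem_image.1 (mapDomain_support h2)
    rw [← hi]
    exact (Finset.mem_Icc.1 i.2).2
  · rintro ⟨π, hπ, h⟩
    refine ⟨_, ⟨π, hπ, rfl⟩, fun i => ?_⟩
    by_cases hi : ∃ k < r, π (μ k) = i
    · obtain ⟨k, hk, rfl⟩ := hi
      rw [hval π hπ k hk]
      exact (h k hk).2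
    · push Not at hi
      rw [finsetSum_apply, Finset.sum_eq_zero]
      · exact Nat.zero_le _
      · intro j hj
        exact single_eq_of_ne' (hi j (Finset.mem_range.1 hj))

lemma hseries_restr_orbitIdeal (K : Type*) [Field K] {r : ℕ} (n : ℕ) {μ a : ℕ → ℕ}
    (hμ : ∀ j, j + 1 < r → μ j < μ (j + 1)) (ha : ∀ j, j < r → 0 < a j) :
    hseries K (restr K (orbitIdeal K (orbMon K r μ a)) n) =
      expSeries (Finset.Icc 1 n) fun u => ¬ OrbitDivides μ a r n u := by
  classical
  ext j
  simp only [hseries, expSeries, PowerSeries.coeff_mk]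
  norm_cast
  have hsum : ∀ u : ℕ →₀ ℕ, u.support ⊆ Finset.Icc 1 n →
      (Finset.Icc 1 n).sum u = u.degree := fun u hu =>
    (Finset.sum_subset hu fun i _ hi => by simpa using hi).symm
  let T : Finset (VarIdx n →₀ ℕ) := {u ∈ Finset.finsuppAntidiag Finset.univ j |
    ¬ OrbitDivides μ a r n (u.mapDomain Subtype.val)}
  rw [hilbF_eq_card (mem_restr_orbitIdeal_iff K hμ ha) j T]
  · have hinv : ∀ u : ℕ →₀ ℕ, u.support ⊆ Finset.Icc 1 n →
        (u.subtypeDomain (· ∈ Finset.Icc 1 n)).mapDomain Subtype.val = u := by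
      intro u hu
      ext i
      by_cases hi : i ∈ Finset.Icc 1 n
      · exact mapDomain_apply Subtype.val_injective
          (u.subtypeDomain (· ∈ Finset.Icc 1 n)) ⟨i, hi⟩
      · rw [mapDomain_of_notMem_range _ _ (by simpa using hi)]
        by_contra h
        exact hi (hu (Finsupp.mem_support_iff.2 (Ne.symm h)))
    have hsupp : ∀ u : VarIdx n →₀ ℕ,
        (u.mapDomain Subtype.val).support ⊆ Finset.Icc 1 n := by
      intro u i hi
      obtain ⟨k, -, rfl⟩ := Finset.mem_image.1 (mapDomain_support hi)
      exact k.2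
    refine Finset.card_bij' (fun u _ => u.mapDomain Subtype.val)
      (fun u _ => u.subtypeDomain (· ∈ Finset.Icc 1 n)) ?_ ?_ ?_ ?_
    · intro u hu
      simp only [T, Finset.mem_filter, Finset.mem_finsuppAntidiag] at hu ⊢
      refine ⟨⟨?_, hsupp u⟩, hu.2⟩
      rw [hsum _ (hsupp u), degree_mapDomain, degree_eq_sum]
      exact hu.1.1
    · intro u hu
      simp only [T, Finset.mem_filter, Finset.mem_finsuppAntidiag] at hu ⊢
      rw [hinv u hu.1.2]
      refine ⟨⟨?_, Finset.subset_univ _⟩, hu.2⟩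
      rw [← hu.1.1]
      exact Finset.sum_coe_sort (Finset.Icc 1 n) u
    · intro u hu
      ext i
      exact mapDomain_apply Subtype.val_injective u i
    · intro u hu
      simp only [Finset.mem_filter, Finset.mem_finsuppAntidiag] at hu
      exact hinv u hu.1.2
  · intro u
    rw [Finset.mem_filter, Finset.mem_finsuppAntidiag, degree_eq_sum]
    simp only [Finset.subset_univ, and_true]

end Membership

section Degree

open Finset

/-- Lagrange interpolation form of the complete homogeneous symmetric polynomial of degree `s`
in `a 0, …, a (r-1)`. -/
def lagrangeSum (a : ℕ → ℕ) (r s : ℕ) : ℚ :=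
  ∑ i ∈ range r, (a i : ℚ) ^ (s + r - 1) / ∏ j ∈ (range r).erase i, ((a i : ℚ) - (a j : ℚ))

variable {a : ℕ → ℕ}

lemma lagrangeSum_zero_right {r : ℕ} (hdist : ∀ i j, i < r + 1 → j < r + 1 → i ≠ j → a i ≠ a j) :
    lagrangeSum a (r + 1) 0 = 1 := by
  have hinj : Set.InjOn (fun i => (a i : ℚ)) (range (r + 1)) := by
    intro i hi j hj h
    by_contra hij
    simp only [coe_range, Set.mem_Iio] at hi hj
    exact hdist i j hi hj hij (Nat.cast_injective h)
  have h := Lagrange.leadingCoeff_eq_sum hinj (P := (Polynomial.X : Polynomial ℚ) ^ r) (by simp)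
  rw [(Polynomial.monic_X_pow r).leadingCoeff] at h
  simpa [lagrangeSum] using h.symm

lemma lagrangeSum_succ {r : ℕ} (hdist : ∀ i j, i < r + 1 → j < r + 1 → i ≠ j → a i ≠ a j)
    (s : ℕ) :
    lagrangeSum a (r + 1) (s + 1) = a r * lagrangeSum a (r + 1) s + lagrangeSum a r (s + 1) := by
  have hterm : ∀ i ∈ range r,
      (a i : ℚ) ^ (s + 1 + (r + 1) - 1) /
          ∏ j ∈ (range (r + 1)).erase i, ((a i : ℚ) - (a j : ℚ)) =
        a r * ((a i : ℚ) ^ (s + (r + 1) - 1) /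
          ∏ j ∈ (range (r + 1)).erase i, ((a i : ℚ) - (a j : ℚ))) +
        (a i : ℚ) ^ (s + 1 + r - 1) / ∏ j ∈ (range r).erase i, ((a i : ℚ) - (a j : ℚ)) := by
    intro i hi
    rw [mem_range] at hi
    have hset : (range (r + 1)).erase i = insert r ((range r).erase i) := by
      rw [range_add_one, erase_insert_of_ne (by omega)]
    have hne : (a i : ℚ) - a r ≠ 0 :=
      sub_ne_zero.2 fun h => hdist i r (by omega) (by omega) (by omega) (Nat.cast_injective h)
    have hprod : ∏ j ∈ (range r).erase i, ((a i : ℚ) - (a j : ℚ)) ≠ 0 := by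
      refine prod_ne_zero_iff.2 fun j hj => sub_ne_zero.2 fun h => ?_
      rw [mem_erase, mem_range] at hj
      exact hdist i j (by omega) (by omega) (by omega) (Nat.cast_injective h)
    rw [hset, prod_insert (by simp), show s + 1 + (r + 1) - 1 = s + r + 1 by omega,
      show s + (r + 1) - 1 = s + r by omega, show s + 1 + r - 1 = s + r by omega]
    field_simp
    ring
  unfold lagrangeSum
  rw [sum_range_succ, sum_congr rfl hterm, sum_add_distrib, ← mul_sum, sum_range_succ _ r,
    show s + 1 + (r + 1) - 1 = s + (r + 1) - 1 + 1 by omega, pow_succ]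
  ring

lemma one_sub_X_mul_cancel {f g : PowerSeries ℤ}
    (h : (1 - PowerSeries.X) * f = (1 - PowerSeries.X) * g) : f = g := by
  refine mul_left_cancel₀ (fun h0 => ?_) h
  simpa using congrArg PowerSeries.constantCoeff h0

/-- Passing from `n` to `n + 1` variables in the Hilbert series of the orbit ideals, after
multiplication by `(1 - t)^{μ_r - 1}`. -/
lemma one_sub_X_pow_mul_expSeries_succ {μ : ℕ → ℕ} {r n : ℕ} (B : (ℕ →₀ ℕ) → Prop)
    (hμ : ∀ j, j < r → μ j < μ (j + 1)) (hB : IndepOf (n + 1) B)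
    (hBu : ∀ u, a r ≤ u (n + 1) → (¬ OrbitDivides μ a (r + 1) (n + 1) u ↔ B u))
    (q₁ q₂ : Polynomial ℤ)
    (h₁ : (q₁ : PowerSeries ℤ) = (1 - PowerSeries.X) ^ (μ r - 1) *
      expSeries (Icc 1 n) fun u => ¬ OrbitDivides μ a (r + 1) n u)
    (h₂ : (1 - PowerSeries.X) * (q₂ : PowerSeries ℤ) =
      (1 - PowerSeries.X) ^ (μ r - 1) * expSeries (Icc 1 n) B) :
    ((q₁ * ∑ i ∈ range (a r), Polynomial.X ^ i + Polynomial.X ^ a r * q₂ : Polynomial ℤ) :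
        PowerSeries ℤ) = (1 - PowerSeries.X) ^ (μ r - 1) *
      expSeries (Icc 1 (n + 1)) fun u => ¬ OrbitDivides μ a (r + 1) (n + 1) u := by
  apply one_sub_X_mul_cancel
  have h := expSeries_insert_of_cases (s := Icc 1 n) (n := n + 1) (by simp)
    (P := fun u => ¬ OrbitDivides μ a (r + 1) (n + 1) u)
    (OrbitDivides.indepOf (μ := μ) (a := a) (r := r + 1) (Nat.lt_succ_self n)) hB (a r)
    (fun u hu => not_congr (orbitDivides_succ_of_lt hμ hu)) hBu
  rw [Finset.insert_Icc_right_eq_Icc_add_one (by omega)] at h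
  have hgeom : ((∑ i ∈ range (a r), Polynomial.X ^ i : Polynomial ℤ) : PowerSeries ℤ) *
      (1 - PowerSeries.X) = 1 - PowerSeries.X ^ a r := by
    have := congrArg (fun p : Polynomial ℤ => (p : PowerSeries ℤ))
      (geom_sum_mul_neg (Polynomial.X : Polynomial ℤ) (a r))
    simpa using this
  rw [Polynomial.coe_add, Polynomial.coe_mul, Polynomial.coe_mul, Polynomial.coe_pow,
    Polynomial.coe_X]
  linear_combination (q₁ : PowerSeries ℤ) * hgeom + (1 - PowerSeries.X ^ a r) * h₁ +
    PowerSeries.X ^ a r * h₂ - (1 - PowerSeries.X) ^ (μ r - 1) * h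

lemma one_sub_X_pow_mul_expSeries_base {μ : ℕ → ℕ} {r : ℕ} (hr : 1 ≤ μ r) :
    ((1 - PowerSeries.X) ^ (μ r - 1) *
      expSeries (Icc 1 (μ r - 1)) fun u => ¬ OrbitDivides μ a (r + 1) (μ r - 1) u) = 1 := by
  rw [expSeries_congr (Q := fun _ => True)
    fun u => iff_true_intro (not_orbitDivides_of_lt (by omega) u)]
  have h := one_sub_X_pow_mul_expSeries (P := fun _ => True) (m := 0) (μ r - 1)
    fun _ _ _ _ _ _ => trivial
  rw [zero_add] at h
  rw [h, Icc_eq_empty (by omega), expSeries_empty_true]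

/-- For `n = μ_r - 1 + s`, the series `(1 - t)^{μ_r - 1} H_{K[X_n]/I_n}(t)` is a polynomial whose
value at `1` is `lagrangeSum`. -/
lemma exists_polynomial_eval_one {μ : ℕ → ℕ} (hμ1 : 1 ≤ μ 0) (r : ℕ)
    (hμ : ∀ j, j < r → μ j < μ (j + 1))
    (hdist : ∀ i j, i < r + 1 → j < r + 1 → i ≠ j → a i ≠ a j) (s : ℕ) :
    ∃ q : Polynomial ℤ, (q : PowerSeries ℤ) = (1 - PowerSeries.X) ^ (μ r - 1) *
      (expSeries (Icc 1 (μ r - 1 + s)) fun u => ¬ OrbitDivides μ a (r + 1) (μ r - 1 + s) u) ∧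
      ((q.eval 1 : ℤ) : ℚ) = lagrangeSum a (r + 1) s := by
  have hpos : ∀ k ≤ r, 1 ≤ μ k := fun k hk => hμ1.trans
    (le_of_forall_lt_succ (r := r + 1) (fun j hj => hμ j (by omega)) (Nat.zero_le k) (by omega))
  induction r generalizing s with
  | zero =>
    induction s with
    | zero =>
      refine ⟨1, ?_, by simp [lagrangeSum_zero_right hdist]⟩
      rw [add_zero, one_sub_X_pow_mul_expSeries_base hμ1, Polynomial.coe_one]
    | succ s ih =>
      obtain ⟨q, hq, hq1⟩ := ih
      refine ⟨_, one_sub_X_pow_mul_expSeries_succ (n := μ 0 - 1 + s) (fun _ => False) hμ (fun _ _ _ h => h)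
        (fun u hu => ?_) q 0 hq ?_, ?_⟩
      · exact iff_of_false (not_not.2 (orbitDivides_one_of_le (by omega) hu)) id
      · simp [expSeries_false]
      · rw [lagrangeSum_succ hdist, ← hq1]
        simp [Polynomial.eval_finsetSum, lagrangeSum, mul_comm]
  | succ r ihr =>
    have h0 := hpos r (by omega)
    have h1 := hμ r (by omega)
    induction s with
    | zero =>
      refine ⟨1, ?_, by simp [lagrangeSum_zero_right hdist]⟩
      rw [add_zero, one_sub_X_pow_mul_expSeries_base (hpos _ le_rfl), Polynomial.coe_one]
    | succ s ih =>
      obtain ⟨q₁, hq₁, hq₁'⟩ := ih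
      obtain ⟨q₂, hq₂, hq₂'⟩ := ihr (fun j hj => hμ j (by omega))
        (fun i j hi hj => hdist i j (by omega) (by omega)) (s + 1) fun k hk => hpos k (by omega)
      have hind : ∀ i, μ r - 1 + (s + 1) < i →
          IndepOf i fun u => ¬ OrbitDivides μ a (r + 1) (μ r - 1 + (s + 1)) u :=
        fun i hi => OrbitDivides.indepOf hi
      refine ⟨_, one_sub_X_pow_mul_expSeries_succ (n := μ (r + 1) - 1 + s)
        (fun u => ¬ OrbitDivides μ a (r + 1) (μ r - 1 + (s + 1)) u) hμ (hind _ (by omega))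
        (fun u hu => ?_) q₁ q₂ hq₁ ?_, ?_⟩
      · have h2 := orbitDivides_succ_of_le hμ (by omega) hu
        rwa [show μ (r + 1) - 1 + s + 1 - (μ (r + 1) - μ r) = μ r - 1 + (s + 1) by omega,
          ← not_iff_not] at h2
      · have h2 := one_sub_X_pow_mul_expSeries (μ (r + 1) - 1 - μ r) hind
        rw [show μ r - 1 + (s + 1) + (μ (r + 1) - 1 - μ r) = μ (r + 1) - 1 + s by omega] at h2
        rw [hq₂, ← h2, ← mul_assoc, ← mul_assoc, ← pow_succ', ← pow_add]
        congr 2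
        omega
      · rw [lagrangeSum_succ hdist, ← hq₁', ← hq₂']
        simp [Polynomial.eval_finsetSum, mul_comm]

end Degree

/-- If `a₁, …, a_r` are pairwise distinct and `n ≥ μ_r - 1`, then in `ℚ`:
`deg I_n = Σᵢ aᵢ^{n-μ_r+r} / ∏_{j≠i} (aᵢ - aⱼ)`, where `deg I_n` is the value at `t = 1` of
the polynomial `(1-t)^{μ_r-1}·H_{K[X_n]/I_n}(t)`. -/
theorem statement10 (K : Type*) [Field K] (r : ℕ) (hr : 1 ≤ r) (μ a : ℕ → ℕ)
    (hμ1 : 1 ≤ μ 0) (hμ : ∀ j, j + 1 < r → μ j < μ (j + 1))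
    (ha : ∀ j, j < r → 0 < a j)
    (hdist : ∀ i j, i < r → j < r → i ≠ j → a i ≠ a j)
    (n : ℕ) (hn : μ (r - 1) ≤ n + 1)
    (p : Polynomial ℤ)
    (hp : (↑p : PowerSeries ℤ) =
      (1 - PowerSeries.X : PowerSeries ℤ) ^ (μ (r - 1) - 1) *
        hseries K (restr K (orbitIdeal K (orbMon K r μ a)) n)) :
    ((p.eval 1 : ℤ) : ℚ) =
      ∑ i ∈ Finset.range r,
        (a i : ℚ) ^ (n + r - μ (r - 1)) /
          ∏ j ∈ (Finset.range r).erase i, ((a i : ℚ) - (a j : ℚ)) := by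
  obtain ⟨r, rfl⟩ : ∃ r', r = r' + 1 := ⟨r - 1, by omega⟩
  rw [Nat.add_sub_cancel] at hn hp ⊢
  have hpos : 1 ≤ μ r := hμ1.trans (le_of_forall_lt_succ hμ (Nat.zero_le r) (Nat.lt_succ_self r))
  obtain ⟨s, rfl⟩ : ∃ s, n = μ r - 1 + s := ⟨n - (μ r - 1), by omega⟩
  obtain ⟨q, hq, hq1⟩ :=
    exists_polynomial_eval_one hμ1 r (fun j hj => hμ j (by omega)) hdist s
  rw [hseries_restr_orbitIdeal K _ hμ ha, ← hq] at hp
  rw [Polynomial.coe_injective ℤ hp, hq1, lagrangeSum,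
    show μ r - 1 + s + (r + 1) - μ r = s + (r + 1) - 1 by omega]
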